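/- Let 1 < α < 2 and for i ∈ ℕ set w_i := (i+1)/( (2i+α+1)(i+α) ) (which equals the squared weighted norm |‖G_i^{(α−1,1)}‖|²). Then there exists a real sequence (f_i)_{i≥2} such that Σ_{i=2}^∞ f_i² / w_i < ∞, but the series Σ_{i=2}^∞ (−1)^i f_i / ( (i+α) w_i ) is not summable (its partial sums are unbounded). (This shows that for r = 1, i.e. β = α−1, the Riemann–Liouville–Caputo fractional diffusion equation with a flux boundary condition at x = 0 is not well posed for arbitrary f ∈ L²_{ρ^{(α−1,1)}}(0,1).) -/

import Mathlib

open Real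

/-- `w_i = (i+1)/((2i+α+1)(i+α))`, the squared weighted norm `|‖G_i^{(α-1,1)}‖|²`. -/
noncomputable def wSeq (α : ℝ) (i : ℕ) : ℝ :=
  ((i : ℝ) + 1) / ((2 * (i : ℝ) + α + 1) * ((i : ℝ) + α))

/-- The slowly decaying weight `1 / (n (log₂ n + 1)^p)`. -/
noncomputable def gAux (p n : ℕ) : ℝ := 1 / ((n : ℝ) * ((Nat.log 2 n : ℝ) + 1) ^ p)

lemma gAux_nonneg (p n : ℕ) : 0 ≤ gAux p n := by
  unfold gAux; positivity

lemma gAux_anti (p : ℕ) ⦃m n : ℕ⦄ (hm : 0 < m) (hmn : m ≤ n) : gAux p n ≤ gAux p m := by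
  unfold gAux
  have h1 : (0 : ℝ) < m := by exact_mod_cast hm
  have h2 : (m : ℝ) ≤ n := by exact_mod_cast hmn
  have h3 : (Nat.log 2 m : ℝ) ≤ Nat.log 2 n := by exact_mod_cast Nat.log_mono_right hmn
  gcongr

lemma gAux_summable_iff (p : ℕ) : Summable (gAux p) ↔ 1 < p := by
  rw [← summable_condensed_iff_of_nonneg (gAux_nonneg p) (gAux_anti p)]
  have h : (fun k : ℕ => (2 : ℝ) ^ k * gAux p (2 ^ k)) =
      fun k : ℕ => (fun n : ℕ => 1 / (n : ℝ) ^ p) (k + 1) := by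
    funext k
    simp only [gAux, Nat.log_pow (by norm_num : 1 < 2)]
    push_cast
    field_simp
  rw [h]
  refine (summable_nat_add_iff (f := fun n : ℕ => 1 / (n : ℝ) ^ p) 1).trans ?_
  exact Real.summable_one_div_nat_pow

theorem stmt17 (α : ℝ) (hα₁ : 1 < α) (hα₂ : α < 2) :
    ∃ f : ℕ → ℝ,
      (Summable fun i : ℕ => (f (i + 2)) ^ 2 / wSeq α (i + 2))
      ∧ ¬ Summable fun i : ℕ =>
          (-1 : ℝ) ^ (i + 2) * f (i + 2) / ((((i : ℕ) + 2 : ℝ) + α) * wSeq α (i + 2)) := by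
  have hα₀ : 0 < α := by linarith
  have ev : ∀ i : ℕ, ((-1 : ℝ) ^ i) * (-1) ^ i = 1 := by
    intro i; rw [← mul_pow]; norm_num
  refine ⟨fun i => (-1) ^ i * gAux 1 i, ?_, ?_⟩
  · have hs := (((summable_nat_add_iff 2).2 ((gAux_summable_iff 2).2 (by norm_num))).mul_left 6)
    refine Summable.of_nonneg_of_le (fun i => ?_) (fun i => ?_) hs
    · unfold wSeq; positivity
    · have hx : (2 : ℝ) ≤ ((i + 2 : ℕ) : ℝ) := by push_cast; linarith [Nat.cast_nonneg (α := ℝ) i]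
      have hw : 1 / wSeq α (i + 2) ≤ 6 * ((i + 2 : ℕ) : ℝ) := by
        unfold wSeq
        generalize ((i + 2 : ℕ) : ℝ) = x at hx
        rw [one_div_div, div_le_iff₀ (by linarith)]
        have : (2 * x + α + 1) * (x + α) ≤ (2 * x + 2 + 1) * (x + 2) := by gcongr
        nlinarith
      have e : ((-1 : ℝ) ^ (i + 2) * gAux 1 (i + 2)) ^ 2 = gAux 1 (i + 2) ^ 2 := by
        rw [mul_pow, pow_two ((-1 : ℝ) ^ (i + 2)), ev, one_mul]
      have e2 : gAux 1 (i + 2) ^ 2 * (6 * ((i + 2 : ℕ) : ℝ)) = 6 * gAux 2 (i + 2) := by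
        unfold gAux
        have : ((i + 2 : ℕ) : ℝ) ≠ 0 := by linarith
        have h2 : ((Nat.log 2 (i + 2) : ℕ) : ℝ) + 1 ≠ 0 := by positivity
        field_simp
      show ((-1 : ℝ) ^ (i + 2) * gAux 1 (i + 2)) ^ 2 / wSeq α (i + 2) ≤ 6 * gAux 2 (i + 2)
      rw [e, ← e2, div_eq_mul_one_div]
      exact mul_le_mul_of_nonneg_left hw (sq_nonneg _)
  · intro hs
    have h1 : Summable fun i : ℕ => gAux 1 (i + 2) := by
      refine Summable.of_nonneg_of_le (fun i => gAux_nonneg _ _) (fun i => ?_) hs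
      have hx : (0 : ℝ) ≤ (i : ℝ) := Nat.cast_nonneg i
      have hw : (((i : ℕ) + 2 : ℝ) + α) * wSeq α (i + 2) =
          ((i : ℝ) + 2 + 1) / (2 * ((i : ℝ) + 2) + α + 1) := by
        unfold wSeq
        push_cast
        have a1 : (i : ℝ) + 2 + α ≠ 0 := by positivity
        have a2 : 2 * ((i : ℝ) + 2) + α + 1 ≠ 0 := by positivity
        field_simp
      rw [hw, ← mul_assoc, ev, one_mul, le_div_iff₀ (by positivity)]
      refine mul_le_of_le_one_right (gAux_nonneg _ _) ?_
      rw [div_le_one (by positivity)]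
      linarith
    exact absurd ((gAux_summable_iff 1).1 ((summable_nat_add_iff 2).1 h1)) (by norm_num)
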